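/- (Ho, expansion of two-move games.) Let a < b be coprime positive integers with a + 1 < b ≤ 2a, and let S = {a, b}. Then the expansion set of S, i.e. the set of positive integers c such that the subtraction game on S ∪ {c} has the same nim-value sequence as the subtraction game on S (G_{S ∪ {c}}(n) = G_S(n) for all n), equals { m + n(a + b) : a ≤ m ≤ b, n ∈ ℕ }. -/

import Mathlib

/-- Nim-value (Sprague–Grundy value) of the subtraction game on `S`:
`subG S n = mex { subG S (n - s) : s ∈ S, s ≤ n }` (moves are positive). -/
noncomputable def subG (S : Finset ℕ) : ℕ → ℕ
  | n => sInf {k : ℕ | ∀ s ∈ S, ∀ (hs : 0 < s) (hn : s ≤ n), subG S (n - s) ≠ k}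
  decreasing_by exact Nat.sub_lt (Nat.lt_of_lt_of_le hs hn) hs

/-- The values of `f` satisfy the mex recursion of the subtraction game on `S`, so `f` is its
nim-value function. -/
theorem subG_eq_of_mex {S : Finset ℕ} {f : ℕ → ℕ}
    (hne : ∀ n, ∀ s ∈ S, 0 < s → s ≤ n → f (n - s) ≠ f n)
    (hlt : ∀ n, ∀ j < f n, ∃ s ∈ S, 0 < s ∧ s ≤ n ∧ f (n - s) = j) (n : ℕ) :
    subG S n = f n := by
  induction n using Nat.strong_induction_on with
  | _ n ih =>
    rw [subG]
    apply le_antisymm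
    · apply Nat.sInf_le
      intro s hs h0 hn
      rw [ih _ (by omega)]
      exact hne n s hs h0 hn
    · refine le_csInf ⟨f n, ?_⟩ ?_
      · intro s hs h0 hn
        rw [ih _ (by omega)]
        exact hne n s hs h0 hn
      · intro k hk
        by_contra! hkn
        obtain ⟨s, hs, h0, hn, hj⟩ := hlt n k hkn
        apply hk s hs h0 hn
        rw [ih _ (by omega), hj]

/-- A move always changes the nim-value. -/
theorem subG_sub_ne {S : Finset ℕ} {n s : ℕ} (hs : s ∈ S) (h0 : 0 < s) (hn : s ≤ n) :
    subG S (n - s) ≠ subG S n := by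
  have hnonempty : {k : ℕ | ∀ s ∈ S, ∀ (_ : 0 < s) (_ : s ≤ n), subG S (n - s) ≠ k}.Nonempty := by
    obtain ⟨k, hk⟩ := Infinite.exists_notMem_finset (S.image fun s => subG S (n - s))
    exact ⟨k, fun s hs _ _ h => hk (Finset.mem_image.2 ⟨s, hs, h⟩)⟩
  have hmem := Nat.sInf_mem hnonempty
  rw [← subG] at hmem
  exact hmem s hs h0 hn

/-- The periodic sequence with period `0^a 1^a 2^(b - a)`. -/
def twoMoveValue (a b n : ℕ) : ℕ :=
  if n % (a + b) < a then 0 else if n % (a + b) < 2 * a then 1 else 2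

theorem twoMoveValue_add_mul {a b r : ℕ} (hr : r < a + b) (q : ℕ) :
    twoMoveValue a b (r + (a + b) * q) = if r < a then 0 else if r < 2 * a then 1 else 2 := by
  simp [twoMoveValue, Nat.mod_eq_of_lt hr]

theorem twoMoveValue_add_ne {a b m : ℕ} (ha : 0 < a) (hub : b ≤ 2 * a)
    (ham : a ≤ m) (hmb : m ≤ b) (x k : ℕ) :
    twoMoveValue a b x ≠ twoMoveValue a b (x + (m + k * (a + b))) := by
  have hr : x % (a + b) < a + b := Nat.mod_lt _ (by omega)
  rw [← Nat.mod_add_div x (a + b)]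
  generalize x % (a + b) = r at hr
  generalize x / (a + b) = q
  rw [twoMoveValue_add_mul hr]
  rcases lt_or_ge (r + m) (a + b) with h | h
  · rw [show r + (a + b) * q + (m + k * (a + b)) = (r + m) + (a + b) * (q + k) by ring,
      twoMoveValue_add_mul h]
    split_ifs <;> omega
  · obtain ⟨t, ht⟩ := Nat.exists_eq_add_of_le h
    rw [show r + (a + b) * q + (m + k * (a + b)) = t + (a + b) * (q + k + 1) by
        linear_combination ht, twoMoveValue_add_mul (by omega)]
    split_ifs <;> omega

theorem exists_twoMoveValue_sub_eq {a b : ℕ} (hab : a < b) (hub : b ≤ 2 * a)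
    {n j : ℕ} (hj : j < twoMoveValue a b n) :
    ∃ s, (s = a ∨ s = b) ∧ s ≤ n ∧ twoMoveValue a b (n - s) = j := by
  have hr : n % (a + b) < a + b := Nat.mod_lt _ (by omega)
  rw [← Nat.mod_add_div n (a + b)] at hj ⊢
  generalize n % (a + b) = r at *
  generalize n / (a + b) = q at *
  rw [twoMoveValue_add_mul hr] at hj
  have hsub : ∀ s ≤ r, twoMoveValue a b (r + (a + b) * q - s) =
      if r - s < a then 0 else if r - s < 2 * a then 1 else 2 := by
    intro s hs
    rw [Nat.sub_add_comm hs, twoMoveValue_add_mul (by omega)]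
  have har : a ≤ r := by
    by_contra h
    simp [not_le.1 h] at hj
  by_cases hb : 2 * a ≤ r ∧ j = 0
  · refine ⟨b, Or.inr rfl, by omega, ?_⟩
    rw [hsub b (by omega)]
    split_ifs <;> omega
  · refine ⟨a, Or.inl rfl, by omega, ?_⟩
    rw [hsub a har]
    split_ifs at * <;> omega

/-- Adding moves from the expansion set to `{a, b}` keeps the nim-values `twoMoveValue a b`. -/
theorem subG_eq_twoMoveValue {a b : ℕ} (ha : 0 < a) (hab : a < b) (hub : b ≤ 2 * a)
    {S : Finset ℕ} (haS : a ∈ S) (hbS : b ∈ S)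
    (hS : ∀ s ∈ S, ∃ m k : ℕ, a ≤ m ∧ m ≤ b ∧ s = m + k * (a + b)) (n : ℕ) :
    subG S n = twoMoveValue a b n := by
  apply subG_eq_of_mex
  · intro n s hs _ hn
    obtain ⟨m, k, ham, hmb, hmk⟩ := hS s hs
    have h := twoMoveValue_add_ne ha hub ham hmb (n - s) k
    rwa [← hmk, Nat.sub_add_cancel hn] at h
  · intro n j hj
    obtain ⟨s, hs, hn, h⟩ := exists_twoMoveValue_sub_eq hab hub hj
    refine ⟨s, ?_, by omega, hn, h⟩
    rcases hs with rfl | rfl <;> assumption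

/-- Ho, expansion of two-move games: for coprime `a < b` with
`a + 1 < b ≤ 2a`, the expansion set of `S = {a, b}` is `{m + n(a+b) : a ≤ m ≤ b, n ∈ ℕ}`. -/
theorem ho_expansion (a b : ℕ) (ha : 0 < a) (hab : a < b)
    (hcop : Nat.Coprime a b) (hlb : a + 1 < b) (hub : b ≤ 2 * a) :
    ∀ c : ℕ, 0 < c →
      ((∀ n : ℕ, subG (insert c {a, b}) n = subG {a, b} n) ↔
        ∃ m k : ℕ, a ≤ m ∧ m ≤ b ∧ c = m + k * (a + b)) := by
  intro c hc
  have hpair : ∀ s ∈ ({a, b} : Finset ℕ), ∃ m k : ℕ, a ≤ m ∧ m ≤ b ∧ s = m + k * (a + b) := by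
    intro s hs
    refine ⟨s, 0, ?_⟩
    simp only [Finset.mem_insert, Finset.mem_singleton] at hs
    omega
  have hG := subG_eq_twoMoveValue ha hab hub (S := {a, b}) (by simp) (by simp) hpair
  constructor
  · intro h
    have hne : ∀ x, twoMoveValue a b x ≠ twoMoveValue a b (x + c) := by
      intro x
      have hx := subG_sub_ne (S := insert c {a, b}) (Finset.mem_insert_self _ _) hc
        (Nat.le_add_left c x)
      rwa [h, h, hG, hG, Nat.add_sub_cancel] at hx
    have hr : c % (a + b) < a + b := Nat.mod_lt _ (by omega)
    have hdiv := Nat.mod_add_div c (a + b)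
    refine ⟨c % (a + b), c / (a + b), ?_, ?_, by rw [mul_comm]; exact hdiv.symm⟩
    · by_contra! hlt
      apply hne 0
      simp [twoMoveValue, hlt, ha]
    · by_contra! hlt
      apply hne (a + b - c % (a + b))
      have hsum : a + b - c % (a + b) + c = 0 + (a + b) * (c / (a + b) + 1) := by
        rw [mul_add]
        omega
      rw [hsum, twoMoveValue_add_mul (by omega), twoMoveValue,
        Nat.mod_eq_of_lt (by omega), if_pos (by omega), if_pos ha]
  · intro hmk n
    rw [hG]
    refine subG_eq_twoMoveValue ha hab hub (by simp) (by simp) ?_ n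
    intro s hs
    rcases Finset.mem_insert.1 hs with rfl | hs
    · exact hmk
    · exact hpair s hs
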